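/- arXiv:2304.00588 — 3 statements merged into one kernel-verified Lean document; each statement's English description precedes it below -/
import Mathlib

section
/- (Colon Principle) Let k ≥ 0 and m ≥ 0 be natural numbers and let X and X' be bulb-headed components with g(X) = g(X') (as elements of ℕ ∪ {∞}). Then g(bulb^k ++ socket^m ++ X) = g(bulb^k ++ socket^m ++ X'). In other words, the extended Grundy value of bulb^k ++ socket^m ++ X depends only on g(X) and not on the shape of X. -/
/-- A piece of a Christmas lights' fixture: a (broken-but-replaceable) bulb
or a (broken) socket. -/
inductive Piece : Type
  | bulb : Piece
  | socket : Piece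
  deriving DecidableEq

/-- A component is a finite list of pieces; index 0 is nearest the plug. -/
abbrev Component := List Piece

/-- A sequence of `n` bulbs. -/
def bulbs (n : ℕ) : Component := List.replicate n Piece.bulb

/-- A sequence of `m` sockets. -/
def sockets (m : ℕ) : Component := List.replicate m Piece.socket

/-- The entries at positions `i-1` and `i+1` both exist and both equal bulb. -/
def Sandwiched (L : Component) (i : ℕ) : Prop :=
  0 < i ∧ L[i-1]? = some Piece.bulb ∧ L[i+1]? = some Piece.bulb

/-- `L'` is obtained from `L` by a quiet move: either fix a bulb (truncating
everything to its right), or remove a socket that is not sandwiched between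
two bulbs. -/
def QuietOption (L L' : Component) : Prop :=
  (∃ i, L[i]? = some Piece.bulb ∧ L' = L.take i) ∨
  (∃ i, L[i]? = some Piece.socket ∧ ¬ Sandwiched L i ∧ L' = L.eraseIdx i)

/-- `L'` is obtained from `L` by a carry-on move: remove a socket sandwiched
between two bulbs (the mover must move again). -/
def CarryOption (L L' : Component) : Prop :=
  ∃ i, L[i]? = some Piece.socket ∧ Sandwiched L i ∧ L' = L.eraseIdx i

/-- A position is a finite multiset of components. -/
abbrev Position := Multiset Component

/-- Total number of pieces in a position. -/
def Position.size (pos : Position) : ℕ := (pos.map List.length).sum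

/-- Fuel-indexed winning predicate; `WinN n pos` agrees with the intended
`Win pos` whenever `n ≥ Position.size pos`, since every move strictly
decreases the total number of pieces. -/
def WinN : ℕ → Position → Prop
  | 0, _ => False
  | n+1, pos =>
      (∃ L ∈ pos, ∃ L', QuietOption L L' ∧ ¬ WinN n (L' ::ₘ pos.erase L)) ∨
      (∃ L ∈ pos, ∃ L', CarryOption L L' ∧ WinN n (L' ::ₘ pos.erase L))

/-- The player to move wins `pos` (normal play convention): some quiet move
leads to a losing position for the opponent, or some carry-on move leads to a
position the mover (still to move) wins. -/
def Win (pos : Position) : Prop := WinN (Position.size pos) pos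

open Classical in
/-- Fuel-indexed extended Grundy value; `gN n L` agrees with the intended
value whenever `n ≥ L.length`, since every option of `L` is strictly
shorter. -/
noncomputable def gN : ℕ → Component → ℕ∞
  | 0, _ => 0
  | n+1, L =>
      let S : Set ℕ := {k | ∃ L', QuietOption L L' ∧ gN n L' = (k : ℕ∞)}
      let C : Set ℕ∞ := {v | ∃ L', CarryOption L L' ∧ gN n L' = v}
      if (⊤ : ℕ∞) ∈ C ∨ (∃ a ∈ C, ∃ b ∈ C, a ≠ b) ∨
          (∃ k : ℕ, C = {(k : ℕ∞)} ∧ k ∈ S) then ⊤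
      else if h : ∃ k : ℕ, C = {(k : ℕ∞)} ∧ k ∉ S then (h.choose : ℕ∞)
      else ((sInf {k : ℕ | k ∉ S} : ℕ) : ℕ∞)

/-- The extended Grundy value `g L ∈ ℕ ∪ {∞}` of a component. -/
noncomputable def g (L : Component) : ℕ∞ := gN L.length L

/-- A component is bulb-headed if it is empty or its first piece is a bulb. -/
def BulbHeaded (L : Component) : Prop := L = [] ∨ L.head? = some Piece.bulb

theorem QuietOption.length_lt {L L' : Component} (h : QuietOption L L') :
    L'.length < L.length := by
  rcases h with ⟨i, hi, rfl⟩ | ⟨i, hi, -, rfl⟩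
  · obtain ⟨h, -⟩ := List.getElem?_eq_some_iff.1 hi
    simpa using h
  · obtain ⟨h, -⟩ := List.getElem?_eq_some_iff.1 hi
    rw [List.length_eraseIdx_of_lt h]
    omega

theorem CarryOption.length_lt {L L' : Component} (h : CarryOption L L') :
    L'.length < L.length := by
  obtain ⟨i, hi, -, rfl⟩ := h
  obtain ⟨h, -⟩ := List.getElem?_eq_some_iff.1 hi
  rw [List.length_eraseIdx_of_lt h]
  omega

theorem finite_setOf_quietOption (L : Component) : {L' | QuietOption L L'}.Finite := by
  refine (List.finite_toSet L.sublists).subset ?_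
  rintro L' (⟨i, -, rfl⟩ | ⟨i, -, -, rfl⟩)
  · exact List.mem_sublists.2 (List.take_sublist i L)
  · exact List.mem_sublists.2 (List.eraseIdx_sublist L i)

open Classical in
/-- The extended Grundy value determined by the set `Q` of values of the quiet options and the set
`C` of values of the carry-on options. -/
noncomputable def extendedMex (Q C : Set ℕ∞) : ℕ∞ :=
  let S : Set ℕ := {k | (k : ℕ∞) ∈ Q}
  if (⊤ : ℕ∞) ∈ C ∨ (∃ a ∈ C, ∃ b ∈ C, a ≠ b) ∨ (∃ k : ℕ, C = {(k : ℕ∞)} ∧ k ∈ S) then ⊤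
  else if h : ∃ k : ℕ, C = {(k : ℕ∞)} ∧ k ∉ S then (h.choose : ℕ∞)
  else ((sInf {k : ℕ | k ∉ S} : ℕ) : ℕ∞)

theorem gN_succ (n : ℕ) (L : Component) :
    gN (n + 1) L =
      extendedMex (gN n '' {L' | QuietOption L L'}) (gN n '' {L' | CarryOption L L'}) := rfl

theorem extendedMex_empty : extendedMex ∅ ∅ = 0 := by
  simp [extendedMex, eq_comm (a := (∅ : Set ℕ∞))]

theorem extendedMex_image_congr {f f' : Component → ℕ∞} {L : Component}
    (h : ∀ L' : Component, L'.length < L.length → f L' = f' L') :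
    extendedMex (f '' {L' | QuietOption L L'}) (f '' {L' | CarryOption L L'}) =
      extendedMex (f' '' {L' | QuietOption L L'}) (f' '' {L' | CarryOption L L'}) := by
  have hq : Set.EqOn f f' {L' | QuietOption L L'} := fun L' hL' => h L' (QuietOption.length_lt hL')
  have hc : Set.EqOn f f' {L' | CarryOption L L'} := fun L' hL' => h L' (CarryOption.length_lt hL')
  rw [hq.image_eq, hc.image_eq]

theorem gN_nil (n : ℕ) : gN n [] = 0 := by
  cases n with
  | zero => rfl
  | succ n =>
    have hq : {L' | QuietOption [] L'} = ∅ :=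
      Set.eq_empty_of_forall_notMem fun L' h => by simpa using QuietOption.length_lt h
    have hc : {L' | CarryOption [] L'} = ∅ :=
      Set.eq_empty_of_forall_notMem fun L' h => by simpa using CarryOption.length_lt h
    rw [gN_succ, hq, hc, Set.image_empty, extendedMex_empty]

theorem gN_eq_gN (n : ℕ) :
    ∀ (m : ℕ) (L : Component), L.length ≤ n → L.length ≤ m → gN n L = gN m L := by
  induction n with
  | zero =>
    intro m L hn _
    rw [List.length_eq_zero_iff.1 (Nat.le_zero.1 hn), gN_nil, gN_nil]
  | succ n ih =>
    intro m L hn hm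
    cases m with
    | zero => rw [List.length_eq_zero_iff.1 (Nat.le_zero.1 hm), gN_nil, gN_nil]
    | succ m =>
      rw [gN_succ, gN_succ]
      exact extendedMex_image_congr fun L' h => ih m L' (by omega) (by omega)

theorem g_nil : g [] = 0 := gN_nil _

theorem g_eq_extendedMex (L : Component) :
    g L = extendedMex (g '' {L' | QuietOption L L'}) (g '' {L' | CarryOption L L'}) := by
  rw [g, gN_eq_gN L.length (L.length + 1) L le_rfl (Nat.le_succ _), gN_succ]
  exact extendedMex_image_congr fun L' h => gN_eq_gN _ _ L' h.le le_rfl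

/-- A choice-free description of `extendedMex Q C = v` for finite `Q`. -/
def IsExtendedMex (Q C : Set ℕ∞) (v : ℕ∞) : Prop :=
  (v = ⊤ ∧ (⊤ ∈ C ∨ (∃ a ∈ C, ∃ b ∈ C, a ≠ b) ∨ ∃ a ∈ C, a ∈ Q)) ∨
  (v ≠ ⊤ ∧ C = {v} ∧ v ∉ Q) ∨
  (v ≠ ⊤ ∧ C = ∅ ∧ v ∉ Q ∧ ∀ i < v, i ∈ Q)

theorem IsExtendedMex.extendedMex_eq {Q C : Set ℕ∞} {v : ℕ∞} (h : IsExtendedMex Q C v) :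
    extendedMex Q C = v := by
  rcases h with ⟨rfl, h⟩ | ⟨hv, rfl, h⟩ | ⟨hv, rfl, h, hlt⟩
  · refine if_pos ?_
    rcases h with h | h | ⟨a, haC, haQ⟩
    · exact Or.inl h
    · exact Or.inr (Or.inl h)
    · by_cases hC : ∃ b ∈ C, b ≠ a
      · obtain ⟨b, hb, hba⟩ := hC
        exact Or.inr (Or.inl ⟨b, hb, a, haC, hba⟩)
      · push Not at hC
        by_cases ha : a = ⊤
        · exact Or.inl (ha ▸ haC)
        · lift a to ℕ using ha
          exact Or.inr (Or.inr ⟨a, Set.eq_singleton_iff_unique_mem.2 ⟨haC, hC⟩, haQ⟩)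
  · lift v to ℕ using hv
    have hC : ∃ k : ℕ, ({(v : ℕ∞)} : Set ℕ∞) = {(k : ℕ∞)} ∧ k ∉ {k : ℕ | (k : ℕ∞) ∈ Q} :=
      ⟨v, rfl, h⟩
    rw [extendedMex, if_neg, dif_pos hC]
    · exact (Set.singleton_injective hC.choose_spec.1).symm
    · rintro (h' | ⟨a, rfl, b, rfl, hab⟩ | ⟨k, hk, hkQ⟩)
      · exact ENat.natCast_ne_top v (Set.mem_singleton_iff.1 h').symm
      · exact hab rfl
      · rw [Set.singleton_injective hk] at h
        exact h hkQ
  · lift v to ℕ using hv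
    have hS : sInf {k : ℕ | k ∉ {k : ℕ | (k : ℕ∞) ∈ Q}} = v := by
      refine IsLeast.csInf_eq ⟨h, fun k hk => ?_⟩
      by_contra! hkv
      exact hk (hlt k (by exact_mod_cast hkv))
    simp [extendedMex, eq_comm (a := (∅ : Set ℕ∞)), ← hS]

theorem isExtendedMex_extendedMex {Q C : Set ℕ∞} (hQ : Q.Finite) :
    IsExtendedMex Q C (extendedMex Q C) := by
  suffices ∃ v, IsExtendedMex Q C v by
    obtain ⟨v, hv⟩ := this
    rwa [hv.extendedMex_eq]
  by_cases hv : ⊤ ∈ C ∨ (∃ a ∈ C, ∃ b ∈ C, a ≠ b) ∨ ∃ a ∈ C, a ∈ Q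
  · exact ⟨⊤, Or.inl ⟨rfl, hv⟩⟩
  push Not at hv
  obtain ⟨htop, huniq, hdisj⟩ := hv
  rcases C.eq_empty_or_nonempty with rfl | ⟨a, ha⟩
  · have hne : ∃ n : ℕ, (n : ℕ∞) ∉ Q := by
      by_contra! hall
      exact Set.infinite_of_injective_forall_mem Nat.cast_injective hall hQ
    classical
    refine ⟨Nat.find hne, Or.inr (Or.inr ⟨ENat.natCast_ne_top _, rfl, Nat.find_spec hne, ?_⟩)⟩
    intro i hi
    lift i to ℕ using hi.ne_top
    exact not_not.1 (Nat.find_min hne (by exact_mod_cast hi))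
  · exact ⟨a, Or.inr (Or.inl ⟨fun h => htop (h ▸ ha),
      Set.eq_singleton_iff_unique_mem.2 ⟨ha, fun b hb => huniq b hb a ha⟩, hdisj a ha⟩)⟩

theorem isExtendedMex_g (L : Component) :
    IsExtendedMex (g '' {L' | QuietOption L L'}) (g '' {L' | CarryOption L L'}) (g L) := by
  rw [g_eq_extendedMex L]
  exact isExtendedMex_extendedMex ((finite_setOf_quietOption L).image g)

theorem g_eq_of_isExtendedMex {L : Component} {v : ℕ∞}
    (h : IsExtendedMex (g '' {L' | QuietOption L L'}) (g '' {L' | CarryOption L L'}) v) :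
    g L = v := by
  rw [g_eq_extendedMex, h.extendedMex_eq]

theorem IsExtendedMex.image {Q C E : Set ℕ∞} {v : ℕ∞} {f : ℕ∞ → ℕ∞} (h : IsExtendedMex Q C v)
    (hf : f.Injective) (htop : f ⊤ = ⊤) (hE : v ≠ ⊤ → f v ∉ E)
    (hlt : v ≠ ⊤ → ∀ j < f v, j ∈ E ∨ ∃ i < v, f i = j) :
    IsExtendedMex (f '' Q ∪ E) (f '' C) (f v) := by
  have hne : v ≠ ⊤ → f v ≠ ⊤ := fun hv h => hv (hf (h.trans htop.symm))
  rcases h with ⟨rfl, h⟩ | ⟨hv, rfl, h⟩ | ⟨hv, rfl, h, hQ⟩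
  · refine Or.inl ⟨htop, ?_⟩
    rcases h with h | ⟨a, ha, b, hb, hab⟩ | ⟨a, haC, haQ⟩
    · exact Or.inl ⟨⊤, h, htop⟩
    · exact Or.inr (Or.inl ⟨f a, ⟨a, ha, rfl⟩, f b, ⟨b, hb, rfl⟩, hf.ne hab⟩)
    · exact Or.inr (Or.inr ⟨f a, ⟨a, haC, rfl⟩, Or.inl ⟨a, haQ, rfl⟩⟩)
  · refine Or.inr (Or.inl ⟨hne hv, Set.image_singleton, ?_⟩)
    rintro (h' | h')
    · exact h (hf.mem_set_image.1 h')
    · exact hE hv h'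
  · refine Or.inr (Or.inr ⟨hne hv, Set.image_empty f, ?_, ?_⟩)
    · rintro (h' | h')
      · exact h (hf.mem_set_image.1 h')
      · exact hE hv h'
    · intro j hj
      rcases hlt hv j hj with h' | ⟨i, hi, rfl⟩
      · exact Or.inr h'
      · exact Or.inl ⟨i, hQ i hi, rfl⟩

theorem BulbHeaded.getElem?_zero_ne {X : Component} (hX : BulbHeaded X) :
    X[0]? ≠ some Piece.socket := by
  rcases hX with rfl | h
  · simp
  · rw [← List.head?_eq_getElem?, h]
    simp

theorem BulbHeaded.quietOption {X X' : Component} (hX : BulbHeaded X) (h : QuietOption X X') :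
    BulbHeaded X' := by
  cases X with
  | nil => simpa using h.length_lt
  | cons a X =>
    rcases h with ⟨i, hi, rfl⟩ | ⟨i, hi, -, rfl⟩
    · cases i <;> simp_all [BulbHeaded]
    · cases i with
      | zero => exact absurd hi hX.getElem?_zero_ne
      | succ i => simp_all [BulbHeaded]

theorem BulbHeaded.carryOption {X X' : Component} (hX : BulbHeaded X) (h : CarryOption X X') :
    BulbHeaded X' := by
  cases X with
  | nil => simpa using h.length_lt
  | cons a X =>
    obtain ⟨i, hi, -, rfl⟩ := h
    cases i with
    | zero => exact absurd hi hX.getElem?_zero_ne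
    | succ i => simp_all [BulbHeaded]

theorem sandwiched_append_iff (p X : Component) {i : ℕ} (hi : 0 < i) :
    Sandwiched (p ++ X) (p.length + i) ↔ Sandwiched X i := by
  have h1 : p.length + i - 1 = p.length + (i - 1) := by omega
  have h2 : p.length + i + 1 = p.length + (i + 1) := by omega
  simp only [Sandwiched, h1, h2, List.getElem?_append_right (Nat.le_add_right _ _),
    Nat.add_sub_cancel_left, hi, Nat.add_pos_right _ hi]

theorem quietOption_append_iff (p : Component) {X L' : Component} (hX : BulbHeaded X) :
    QuietOption (p ++ X) L' ↔ (∃ X', QuietOption X X' ∧ p ++ X' = L') ∨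
      (∃ i < p.length, p[i]? = some Piece.bulb ∧ L' = p.take i) ∨
      ∃ i < p.length, p[i]? = some Piece.socket ∧ ¬ Sandwiched (p ++ X) i ∧
        L' = p.eraseIdx i ++ X := by
  constructor
  · rintro (⟨i, hi, rfl⟩ | ⟨i, hi, hs, rfl⟩)
    · rcases lt_or_ge i p.length with h | h
      · rw [List.getElem?_append_left h] at hi
        exact Or.inr (Or.inl ⟨i, h, hi, List.take_append_of_le_length h.le⟩)
      · obtain ⟨i, rfl⟩ := Nat.exists_eq_add_of_le h
        rw [List.getElem?_append_right h, Nat.add_sub_cancel_left] at hi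
        exact Or.inl ⟨X.take i, Or.inl ⟨i, hi, rfl⟩, by simp [List.take_append]⟩
    · rcases lt_or_ge i p.length with h | h
      · rw [List.getElem?_append_left h] at hi
        exact Or.inr (Or.inr ⟨i, h, hi, hs, List.eraseIdx_append_of_lt_length h X⟩)
      · obtain ⟨i, rfl⟩ := Nat.exists_eq_add_of_le h
        rw [List.getElem?_append_right h, Nat.add_sub_cancel_left] at hi
        have hi0 : 0 < i := Nat.pos_of_ne_zero fun h => hX.getElem?_zero_ne (h ▸ hi)
        rw [sandwiched_append_iff p X hi0] at hs
        exact Or.inl ⟨X.eraseIdx i, Or.inr ⟨i, hi, hs, rfl⟩, by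
          rw [List.eraseIdx_append_of_length_le h, Nat.add_sub_cancel_left]⟩
  · rintro (⟨X', ⟨i, hi, rfl⟩ | ⟨i, hi, hs, rfl⟩, rfl⟩ | ⟨i, h, hi, rfl⟩ | ⟨i, h, hi, hs, rfl⟩)
    · refine Or.inl ⟨p.length + i, ?_, by simp [List.take_append]⟩
      rwa [List.getElem?_append_right (Nat.le_add_right _ _), Nat.add_sub_cancel_left]
    · have hi0 : 0 < i := Nat.pos_of_ne_zero fun h => hX.getElem?_zero_ne (h ▸ hi)
      refine Or.inr ⟨p.length + i, ?_, ?_, ?_⟩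
      · rwa [List.getElem?_append_right (Nat.le_add_right _ _), Nat.add_sub_cancel_left]
      · rwa [sandwiched_append_iff p X hi0]
      · rw [List.eraseIdx_append_of_length_le (Nat.le_add_right _ _), Nat.add_sub_cancel_left]
    · exact Or.inl ⟨i, by rwa [List.getElem?_append_left h],
        (List.take_append_of_le_length h.le).symm⟩
    · exact Or.inr ⟨i, by rwa [List.getElem?_append_left h], hs,
        (List.eraseIdx_append_of_lt_length h X).symm⟩

theorem carryOption_append_iff (p : Component) {X L' : Component} (hX : BulbHeaded X) :
    CarryOption (p ++ X) L' ↔ (∃ X', CarryOption X X' ∧ p ++ X' = L') ∨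
      ∃ i < p.length, p[i]? = some Piece.socket ∧ Sandwiched (p ++ X) i ∧
        L' = p.eraseIdx i ++ X := by
  constructor
  · rintro ⟨i, hi, hs, rfl⟩
    rcases lt_or_ge i p.length with h | h
    · rw [List.getElem?_append_left h] at hi
      exact Or.inr ⟨i, h, hi, hs, List.eraseIdx_append_of_lt_length h X⟩
    · obtain ⟨i, rfl⟩ := Nat.exists_eq_add_of_le h
      rw [List.getElem?_append_right h, Nat.add_sub_cancel_left] at hi
      have hi0 : 0 < i := Nat.pos_of_ne_zero fun h => hX.getElem?_zero_ne (h ▸ hi)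
      rw [sandwiched_append_iff p X hi0] at hs
      exact Or.inl ⟨X.eraseIdx i, ⟨i, hi, hs, rfl⟩, by
        rw [List.eraseIdx_append_of_length_le h, Nat.add_sub_cancel_left]⟩
  · rintro (⟨X', ⟨i, hi, hs, rfl⟩, rfl⟩ | ⟨i, h, hi, hs, rfl⟩)
    · refine ⟨p.length + i, ?_, ?_, ?_⟩
      · rwa [List.getElem?_append_right (Nat.le_add_right _ _), Nat.add_sub_cancel_left]
      · rwa [sandwiched_append_iff p X hs.1]
      · rw [List.eraseIdx_append_of_length_le (Nat.le_add_right _ _), Nat.add_sub_cancel_left]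
    · exact ⟨i, by rwa [List.getElem?_append_left h], hs,
        (List.eraseIdx_append_of_lt_length h X).symm⟩

/-- The extension of `φ` to `ℕ∞` that fixes `⊤`. -/
def mapFinite (φ : ℕ → ℕ) (v : ℕ∞) : ℕ∞ := ENat.map φ v

theorem mapFinite_coe (φ : ℕ → ℕ) (n : ℕ) : mapFinite φ n = φ n := rfl

theorem mapFinite_top (φ : ℕ → ℕ) : mapFinite φ ⊤ = ⊤ := rfl

theorem mapFinite_injective {φ : ℕ → ℕ} (hφ : φ.Injective) : (mapFinite φ).Injective :=
  Option.map_injective hφ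

/-- If prepending `p` adds only the quiet options `E X` and shifts values suitably, then it acts on
values by a fixed injective function. -/
theorem g_append_eq_map (p : Component) (E : Component → Set Component) {φ : ℕ → ℕ}
    (hφ : φ.Injective)
    (hQ : ∀ X L', BulbHeaded X →
      (QuietOption (p ++ X) L' ↔ (∃ X', QuietOption X X' ∧ p ++ X' = L') ∨ L' ∈ E X))
    (hC : ∀ X L', BulbHeaded X →
      (CarryOption (p ++ X) L' ↔ ∃ X', CarryOption X X' ∧ p ++ X' = L'))
    (hE : ∀ (X : Component) (n : ℕ), BulbHeaded X → g X = n → ∀ Y ∈ E X, g Y ≠ φ n)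
    (hlt : ∀ (X : Component) (n : ℕ), BulbHeaded X → g X = n → ∀ j < φ n,
      (∃ Y ∈ E X, g Y = j) ∨ ∃ i < n, φ i = j) :
    ∀ X : Component, BulbHeaded X → g (p ++ X) = mapFinite φ (g X) := by
  intro X hX
  induction hn : X.length using Nat.strong_induction_on generalizing X with
  | _ N ih =>
    subst hn
    refine g_eq_of_isExtendedMex ?_
    have hq : g '' {L' | QuietOption (p ++ X) L'} =
        mapFinite φ '' (g '' {L' | QuietOption X L'}) ∪ g '' E X := by
      have : {L' | QuietOption (p ++ X) L'} = (p ++ ·) '' {L' | QuietOption X L'} ∪ E X :=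
        Set.ext fun L' => hQ X L' hX
      rw [this, Set.image_union, Set.image_image, Set.image_image]
      congr 1
      exact Set.image_congr fun X' h =>
        ih _ (QuietOption.length_lt h) X' (hX.quietOption h) rfl
    have hc : g '' {L' | CarryOption (p ++ X) L'} =
        mapFinite φ '' (g '' {L' | CarryOption X L'}) := by
      have : {L' | CarryOption (p ++ X) L'} = (p ++ ·) '' {L' | CarryOption X L'} :=
        Set.ext fun L' => hC X L' hX
      rw [this, Set.image_image, Set.image_image]
      exact Set.image_congr fun X' h =>
        ih _ (CarryOption.length_lt h) X' (hX.carryOption h) rfl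
    rw [hq, hc]
    refine (isExtendedMex_g X).image (mapFinite_injective hφ) (mapFinite_top φ) ?_ ?_
    · rintro hv ⟨Y, hY, h⟩
      obtain ⟨n, hn⟩ := ENat.ne_top_iff_exists.1 hv
      rw [← hn, mapFinite_coe] at h
      exact hE X n hX hn.symm Y hY h
    · intro hv j hj
      obtain ⟨n, hn⟩ := ENat.ne_top_iff_exists.1 hv
      rw [← hn, mapFinite_coe] at hj
      lift j to ℕ using hj.ne_top
      rcases hlt X n hX hn.symm j (by exact_mod_cast hj) with ⟨Y, hY, h⟩ | ⟨i, hi, rfl⟩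
      · exact Or.inl ⟨Y, hY, h⟩
      · exact Or.inr ⟨i, by rw [← hn]; exact_mod_cast hi, mapFinite_coe φ i⟩

theorem getElem?_sockets_eq_bulb (m i : ℕ) : (sockets m)[i]? ≠ some Piece.bulb := by
  simp [sockets, List.getElem?_replicate]

theorem getElem?_sockets {m i : ℕ} (h : i < m) : (sockets m)[i]? = some Piece.socket := by
  simp [sockets, h]

theorem length_sockets (m : ℕ) : (sockets m).length = m := List.length_replicate

theorem eraseIdx_sockets {m i : ℕ} (h : i < m + 1) : (sockets (m + 1)).eraseIdx i = sockets m := by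
  simp [sockets, List.eraseIdx_replicate, h]

theorem not_sandwiched_sockets_append {m i : ℕ} (X : Component) (h : i < m) :
    ¬ Sandwiched (sockets m ++ X) i := by
  rintro ⟨-, h1, -⟩
  rw [List.getElem?_append_left (by rw [length_sockets]; omega)] at h1
  exact getElem?_sockets_eq_bulb _ _ h1

theorem quietOption_sockets_append_iff (m : ℕ) {X L' : Component} (hX : BulbHeaded X) :
    QuietOption (sockets (m + 1) ++ X) L' ↔
      (∃ X', QuietOption X X' ∧ sockets (m + 1) ++ X' = L') ∨ L' ∈ ({sockets m ++ X} : Set _) := by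
  rw [quietOption_append_iff _ hX, length_sockets]
  refine or_congr_right ⟨?_, ?_⟩
  · rintro (⟨i, -, h, -⟩ | ⟨i, h, -, -, rfl⟩)
    · exact absurd h (getElem?_sockets_eq_bulb _ _)
    · rw [eraseIdx_sockets h]
      rfl
  · rintro rfl
    exact Or.inr ⟨0, Nat.succ_pos m, getElem?_sockets (Nat.succ_pos m),
      not_sandwiched_sockets_append X (Nat.succ_pos m), by rw [eraseIdx_sockets (Nat.succ_pos m)]⟩

theorem carryOption_sockets_append_iff (m : ℕ) {X L' : Component} (hX : BulbHeaded X) :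
    CarryOption (sockets m ++ X) L' ↔ ∃ X', CarryOption X X' ∧ sockets m ++ X' = L' := by
  rw [carryOption_append_iff _ hX, length_sockets]
  refine or_iff_left ?_
  rintro ⟨i, h, -, hs, -⟩
  exact not_sandwiched_sockets_append X h hs

/-- The effect on finite values of prepending `m` sockets. -/
def socketShift (m n : ℕ) : ℕ :=
  if m % 2 = 0 then n else if n % 2 = 0 then n + 1 else n - 1

theorem socketShift_injective (m : ℕ) : (socketShift m).Injective := by
  intro a b h
  simp only [socketShift] at h
  split_ifs at h <;> omega

theorem g_sockets_append (m : ℕ) :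
    ∀ X : Component, BulbHeaded X → g (sockets m ++ X) = mapFinite (socketShift m) (g X) := by
  induction m with
  | zero =>
    intro X _
    have h : socketShift 0 = id := funext fun n => if_pos rfl
    rw [h, mapFinite, show ENat.map id (g X) = g X from congrFun Option.map_id (g X)]
    rfl
  | succ m ih =>
    refine g_append_eq_map _ (fun X => {sockets m ++ X}) (socketShift_injective _)
      (fun X L' => quietOption_sockets_append_iff m)
      (fun X L' => carryOption_sockets_append_iff (m + 1)) ?_ ?_
    · rintro X n hX hn Y rfl
      rw [ih X hX, hn, mapFinite_coe, ne_eq, Nat.cast_inj]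
      simp only [socketShift]
      split_ifs <;> omega
    · intro X n hX hn j hj
      simp only [Set.mem_singleton_iff, exists_eq_left, ih X hX, hn, mapFinite_coe, Nat.cast_inj]
      by_cases hjn : socketShift m n = j
      · exact Or.inl hjn
      · refine Or.inr ⟨socketShift (m + 1) j, ?_, ?_⟩ <;> simp only [socketShift] at hj hjn ⊢ <;>
          split_ifs at hj hjn ⊢ <;> omega

theorem quietOption_bulb_append_iff {X L' : Component} (hX : BulbHeaded X) :
    QuietOption ([Piece.bulb] ++ X) L' ↔
      (∃ X', QuietOption X X' ∧ [Piece.bulb] ++ X' = L') ∨ L' ∈ ({[]} : Set Component) := by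
  rw [quietOption_append_iff _ hX]
  simp

theorem carryOption_bulb_append_iff {X L' : Component} (hX : BulbHeaded X) :
    CarryOption ([Piece.bulb] ++ X) L' ↔ ∃ X', CarryOption X X' ∧ [Piece.bulb] ++ X' = L' := by
  rw [carryOption_append_iff _ hX]
  simp

theorem g_bulb_cons (X : Component) (hX : BulbHeaded X) :
    g (Piece.bulb :: X) = mapFinite Nat.succ (g X) := by
  refine g_append_eq_map [Piece.bulb] (fun _ => {[]}) Nat.succ_injective
    (fun X L' => quietOption_bulb_append_iff) (fun X L' => carryOption_bulb_append_iff) ?_ ?_ X hX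
  · rintro X n - - Y rfl
    rw [g_nil]
    exact_mod_cast (Nat.succ_ne_zero n).symm
  · intro X n _ _ j hj
    cases j with
    | zero => exact Or.inl ⟨[], rfl, g_nil⟩
    | succ j => exact Or.inr ⟨j, Nat.lt_of_succ_lt_succ hj, rfl⟩

theorem bulbHeaded_cons (X : Component) : BulbHeaded (Piece.bulb :: X) := Or.inr rfl

theorem g_bulbs_append (k : ℕ) {X : Component} (hX : BulbHeaded X) :
    BulbHeaded (bulbs k ++ X) ∧ g (bulbs k ++ X) = (mapFinite Nat.succ)^[k] (g X) := by
  induction k with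
  | zero => exact ⟨hX, rfl⟩
  | succ k ih =>
    refine ⟨bulbHeaded_cons _, ?_⟩
    rw [Function.iterate_succ_apply', ← ih.2, ← g_bulb_cons _ ih.1]
    rfl

theorem quietOption_bulb_socket_append_iff {X L' : Component} (hX : BulbHeaded X) (hne : X ≠ []) :
    QuietOption (Piece.bulb :: Piece.socket :: X) L' ↔
      (∃ X', QuietOption X X' ∧ Piece.bulb :: Piece.socket :: X' = L') ∨ L' = [] := by
  have h : X[0]? = some Piece.bulb := List.head?_eq_getElem? ▸ hX.resolve_left hne
  have := quietOption_append_iff [Piece.bulb, Piece.socket] (L' := L') hX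
  simpa [Nat.lt_succ_iff, Nat.le_one_iff_eq_zero_or_eq_one, or_and_right, exists_or, Sandwiched, h]
    using this

theorem carryOption_bulb_socket_append_iff {X L' : Component} (hX : BulbHeaded X) (hne : X ≠ []) :
    CarryOption (Piece.bulb :: Piece.socket :: X) L' ↔
      (∃ X', CarryOption X X' ∧ Piece.bulb :: Piece.socket :: X' = L') ∨
        L' = Piece.bulb :: X := by
  have h : X[0]? = some Piece.bulb := List.head?_eq_getElem? ▸ hX.resolve_left hne
  have := carryOption_append_iff [Piece.bulb, Piece.socket] (L' := L') hX
  simpa [Nat.lt_succ_iff, Nat.le_one_iff_eq_zero_or_eq_one, or_and_right, exists_or, Sandwiched, h]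
    using this

theorem BulbHeaded.quietOption_nil {X : Component} (hX : BulbHeaded X) (hne : X ≠ []) :
    QuietOption X [] :=
  Or.inl ⟨0, List.head?_eq_getElem? ▸ hX.resolve_left hne, rfl⟩

theorem BulbHeaded.g_ne_zero {X : Component} (hX : BulbHeaded X) (hne : X ≠ []) : g X ≠ 0 := by
  have h0 : (0 : ℕ∞) ∈ g '' {L' | QuietOption X L'} := ⟨[], hX.quietOption_nil hne, g_nil⟩
  rcases isExtendedMex_g X with ⟨h, -⟩ | ⟨-, -, h⟩ | ⟨-, -, h, -⟩
  · simp [h]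
  · exact fun h' => h (h' ▸ h0)
  · exact fun h' => h (h' ▸ h0)

theorem g_bulb_socket : g [Piece.bulb, Piece.socket] = 2 := by
  have hQ : {L' | QuietOption [Piece.bulb, Piece.socket] L'} = {[], [Piece.bulb]} := by
    ext L'
    have h := quietOption_append_iff [Piece.bulb, Piece.socket] (X := []) (L' := L') (Or.inl rfl)
    have hq : ∀ X', ¬ QuietOption [] X' := fun X' h => by simpa using h.length_lt
    simpa [Nat.lt_succ_iff, Nat.le_one_iff_eq_zero_or_eq_one, or_and_right, exists_or, Sandwiched,
      hq] using h
  have hC : {L' | CarryOption [Piece.bulb, Piece.socket] L'} = ∅ := by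
    ext L'
    have h := carryOption_append_iff [Piece.bulb, Piece.socket] (X := []) (L' := L') (Or.inl rfl)
    have hq : ∀ X', ¬ CarryOption [] X' := fun X' h => by simpa using h.length_lt
    simpa [Nat.lt_succ_iff, Nat.le_one_iff_eq_zero_or_eq_one, or_and_right, exists_or, Sandwiched,
      hq] using h
  have h1 : g [Piece.bulb] = 1 := by
    rw [g_bulb_cons [] (Or.inl rfl), g_nil]
    rfl
  refine g_eq_of_isExtendedMex (Or.inr (Or.inr ⟨by simp, by simp [hC], ?_, ?_⟩))
  · simp [hQ, Set.image_pair, g_nil, h1]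
  · intro i hi
    lift i to ℕ using hi.ne_top
    have : i < 2 := by exact_mod_cast hi
    rw [hQ, Set.image_pair, g_nil, h1]
    interval_cases i <;> simp

/-- The effect on values of prepending a bulb and a socket. -/
noncomputable def bulbSocketValue (v : ℕ∞) : ℕ∞ :=
  if v = 0 then 2 else if v = 1 then ⊤ else mapFinite Nat.succ v

theorem g_bulb_socket_append (X : Component) (hX : BulbHeaded X) :
    g (Piece.bulb :: Piece.socket :: X) = bulbSocketValue (g X) := by
  induction hn : X.length using Nat.strong_induction_on generalizing X with
  | _ N ih =>
    subst hn
    by_cases hne : X = []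
    · rw [hne, g_bulb_socket, g_nil, bulbSocketValue, if_pos rfl]
    have hcarry : Piece.bulb :: X ∈ {L' | CarryOption (Piece.bulb :: Piece.socket :: X) L'} :=
      (carryOption_bulb_socket_append_iff hX hne).2 (Or.inr rfl)
    have hquiet : [Piece.bulb, Piece.socket] ∈
        {L' | QuietOption (Piece.bulb :: Piece.socket :: X) L'} :=
      (quietOption_bulb_socket_append_iff hX hne).2 (Or.inl ⟨[], hX.quietOption_nil hne, rfl⟩)
    have h0 := hX.g_ne_zero hne
    refine g_eq_of_isExtendedMex ?_
    rw [bulbSocketValue, if_neg h0]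
    by_cases h1 : g X = 1
    · rw [if_pos h1]
      refine Or.inl ⟨rfl, Or.inr (Or.inr ⟨2, ⟨_, hcarry, ?_⟩, ⟨_, hquiet, g_bulb_socket⟩⟩)⟩
      rw [g_bulb_cons X hX, h1]
      rfl
    rw [if_neg h1]
    by_cases htop : g X = ⊤
    · rw [htop, mapFinite_top]
      exact Or.inl ⟨rfl, Or.inl ⟨_, hcarry, by rw [g_bulb_cons X hX, htop, mapFinite_top]⟩⟩
    have hinj := mapFinite_injective Nat.succ_injective
    have hval := isExtendedMex_g X
    have hCX : ∀ X', CarryOption X X' → g X' = g X := by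
      intro X' h
      have hmem : g X' ∈ g '' {L' | CarryOption X L'} := ⟨X', h, rfl⟩
      rcases hval with ⟨h', -⟩ | ⟨-, h', -⟩ | ⟨-, h', -⟩
      · exact absurd h' htop
      · rwa [h'] at hmem
      · rw [h'] at hmem
        exact hmem.elim
    have hQX : ∀ X', QuietOption X X' → g X' ≠ g X := by
      intro X' h h'
      have hmem : g X ∈ g '' {L' | QuietOption X L'} := ⟨X', h, h'⟩
      rcases hval with ⟨h', -⟩ | ⟨-, -, h'⟩ | ⟨-, -, h', -⟩
      · exact htop h'
      · exact h' hmem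
      · exact h' hmem
    obtain ⟨n, hn⟩ := ENat.ne_top_iff_exists.1 htop
    refine Or.inr (Or.inl ⟨?_, ?_, ?_⟩)
    · rw [← hn, mapFinite_coe]
      exact ENat.natCast_ne_top _
    · refine Set.eq_singleton_iff_unique_mem.2 ⟨⟨_, hcarry, g_bulb_cons X hX⟩, ?_⟩
      rintro _ ⟨L', hL', rfl⟩
      rcases (carryOption_bulb_socket_append_iff hX hne).1 hL' with ⟨X', h, rfl⟩ | rfl
      · rw [ih _ h.length_lt X' (hX.carryOption h) rfl, hCX X' h, bulbSocketValue, if_neg h0,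
          if_neg h1]
      · exact g_bulb_cons X hX
    · rintro ⟨L', hL', h⟩
      rcases (quietOption_bulb_socket_append_iff hX hne).1 hL' with ⟨X', hX', rfl⟩ | rfl
      · rw [ih _ hX'.length_lt X' (hX.quietOption hX') rfl, bulbSocketValue] at h
        split_ifs at h
        · rw [← hn, Nat.cast_eq_one] at h1
          rw [← hn, mapFinite_coe] at h
          have : 2 = n.succ := by exact_mod_cast h
          omega
        · rw [← hn, mapFinite_coe] at h
          exact ENat.natCast_ne_top _ h.symm
        · exact hQX X' hX' (hinj h)
      · rw [g_nil, ← hn, mapFinite_coe] at h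
        exact absurd h.symm (by simp)

theorem not_sandwiched_bulb_sockets_append {m i : ℕ} (X : Component) (h : i < m + 3) :
    ¬ Sandwiched (Piece.bulb :: sockets (m + 2) ++ X) i := by
  rintro ⟨h0, h1, h2⟩
  obtain ⟨i, rfl⟩ := Nat.exists_eq_add_of_lt h0
  rw [List.cons_append] at h1 h2
  rcases Nat.eq_zero_or_pos i with rfl | hi
  · rw [List.getElem?_cons_succ, List.getElem?_append_left (by rw [length_sockets]; omega)] at h2
    exact getElem?_sockets_eq_bulb _ _ h2
  · obtain ⟨i, rfl⟩ := Nat.exists_eq_add_of_lt hi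
    rw [Nat.add_sub_cancel, Nat.zero_add, Nat.zero_add, List.getElem?_cons_succ,
      List.getElem?_append_left (by rw [length_sockets]; omega)] at h1
    exact getElem?_sockets_eq_bulb _ _ h1

theorem quietOption_bulb_sockets_append_iff (m : ℕ) {X L' : Component} (hX : BulbHeaded X) :
    QuietOption (Piece.bulb :: sockets (m + 2) ++ X) L' ↔
      (∃ X', QuietOption X X' ∧ Piece.bulb :: sockets (m + 2) ++ X' = L') ∨
        L' ∈ ({[], Piece.bulb :: sockets (m + 1) ++ X} : Set Component) := by
  rw [quietOption_append_iff _ hX, List.length_cons, length_sockets]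
  refine or_congr_right ⟨?_, ?_⟩
  · rintro (⟨i, -, h, rfl⟩ | ⟨i, h, hi, -, rfl⟩)
    · cases i with
      | zero => exact Or.inl rfl
      | succ i =>
        rw [List.getElem?_cons_succ] at h
        exact absurd h (getElem?_sockets_eq_bulb _ _)
    · cases i with
      | zero => simp at hi
      | succ i =>
        rw [List.eraseIdx_cons_succ, eraseIdx_sockets (by omega)]
        exact Or.inr rfl
  · rintro (rfl | rfl)
    · exact Or.inl ⟨0, by omega, rfl, rfl⟩
    · exact Or.inr ⟨1, by omega, getElem?_sockets (Nat.succ_pos (m + 1)),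
        not_sandwiched_bulb_sockets_append X (by omega), rfl⟩

theorem carryOption_bulb_sockets_append_iff (m : ℕ) {X L' : Component} (hX : BulbHeaded X) :
    CarryOption (Piece.bulb :: sockets (m + 2) ++ X) L' ↔
      ∃ X', CarryOption X X' ∧ Piece.bulb :: sockets (m + 2) ++ X' = L' := by
  rw [carryOption_append_iff _ hX, List.length_cons, length_sockets]
  refine or_iff_left ?_
  rintro ⟨i, h, -, hs, -⟩
  exact not_sandwiched_bulb_sockets_append X h hs

/-- The effect on finite values of prepending a bulb and `m` sockets, for `m ≥ 2`. -/
def bulbSocketsShift (m n : ℕ) : ℕ :=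
  if m % 2 = 0 then
    if n = 0 then 1 else if n = 1 then 2 else if n % 2 = 0 then n + 2 else n
  else if n = 0 then 2 else if n = 1 then 1 else n + 1

theorem bulbSocketsShift_injective (m : ℕ) : (bulbSocketsShift m).Injective := by
  intro a b h
  simp only [bulbSocketsShift] at h
  split_ifs at h <;> omega

theorem bulbSocketsShift_ne_zero (m n : ℕ) : bulbSocketsShift m n ≠ 0 := by
  simp only [bulbSocketsShift]
  split_ifs <;> omega

theorem exists_bulbSocketsShift_eq {m n j : ℕ} (hj0 : j ≠ 0) (hj : j < bulbSocketsShift m n) :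
    (bulbSocketsShift (m + 1) n = j ∧ (m % 2 = 0 → 2 ≤ n)) ∨
      ∃ i < n, bulbSocketsShift m i = j := by
  rcases Nat.mod_two_eq_zero_or_one m with hm | hm
  · have hm' : (m + 1) % 2 = 1 := by omega
    simp only [bulbSocketsShift, hm, hm', if_true, one_ne_zero, if_false] at hj ⊢
    by_cases hjn : 2 ≤ n ∧ j = n + 1
    · refine Or.inl ⟨?_, fun _ => hjn.1⟩
      rw [if_neg (by omega), if_neg (by omega), hjn.2]
    · right
      have hcases : j = 1 ∨ j = 2 ∨ j % 2 = 0 ∧ 4 ≤ j ∨ j % 2 = 1 ∧ 3 ≤ j := by omega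
      rcases hcases with h | h | ⟨h, h'⟩ | ⟨h, h'⟩
      · refine ⟨0, ?_, ?_⟩ <;> grind
      · refine ⟨1, ?_, ?_⟩ <;> grind
      · refine ⟨j - 2, ?_, ?_⟩ <;> grind
      · refine ⟨j, ?_, ?_⟩ <;> grind
  · have hm' : (m + 1) % 2 = 0 := by omega
    simp only [bulbSocketsShift, hm, hm', if_true, one_ne_zero, if_false] at hj ⊢
    by_cases hjn : n = 0 ∧ j = 1
    · left
      grind
    · right
      have hcases : j = 1 ∨ j = 2 ∨ 3 ≤ j := by omega
      rcases hcases with h | h | h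
      · refine ⟨1, ?_, ?_⟩ <;> grind
      · refine ⟨0, ?_, ?_⟩ <;> grind
      · refine ⟨j - 1, ?_, ?_⟩ <;> grind

theorem g_bulb_sockets_append (m : ℕ) : ∀ X : Component, BulbHeaded X →
    g (Piece.bulb :: sockets (m + 2) ++ X) = mapFinite (bulbSocketsShift (m + 2)) (g X) := by
  induction m with
  | zero =>
    have hone : ∀ X, BulbHeaded X →
        g (Piece.bulb :: sockets (0 + 1) ++ X) = bulbSocketValue (g X) := g_bulb_socket_append
    refine g_append_eq_map _ (fun X => {[], Piece.bulb :: sockets (0 + 1) ++ X})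
      (bulbSocketsShift_injective _) (fun X L' => quietOption_bulb_sockets_append_iff 0)
      (fun X L' => carryOption_bulb_sockets_append_iff 0) ?_ ?_
    · rintro X n hX hn Y (rfl | rfl)
      · rw [g_nil]
        exact_mod_cast (bulbSocketsShift_ne_zero _ _).symm
      · rw [hone X hX, hn, bulbSocketValue]
        split_ifs with h0 h1
        · obtain rfl : n = 0 := by exact_mod_cast h0
          simp [bulbSocketsShift]
        · exact (ENat.natCast_ne_top _).symm
        · rw [mapFinite_coe, ne_eq, Nat.cast_inj]
          simp only [Nat.cast_eq_zero, Nat.cast_eq_one] at h0 h1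
          simp only [bulbSocketsShift]
          split_ifs <;> omega
    · intro X n hX hn j hj
      by_cases hj0 : j = 0
      · exact Or.inl ⟨[], Or.inl rfl, by rw [g_nil, hj0]; rfl⟩
      refine (exists_bulbSocketsShift_eq hj0 hj).imp_left fun ⟨h, h2⟩ => ⟨_, Or.inr rfl, ?_⟩
      have hn2 : 2 ≤ n := h2 rfl
      have h0 : n ≠ 0 := by omega
      have h1 : n ≠ 1 := by omega
      rw [hone X hX, hn, bulbSocketValue, if_neg (by exact_mod_cast h0),
        if_neg (by exact_mod_cast h1), mapFinite_coe, ← h]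
      simp [bulbSocketsShift, h0, h1]
  | succ m ih =>
    refine g_append_eq_map _ (fun X => {[], Piece.bulb :: sockets (m + 2) ++ X})
      (bulbSocketsShift_injective _) (fun X L' => quietOption_bulb_sockets_append_iff (m + 1))
      (fun X L' => carryOption_bulb_sockets_append_iff (m + 1)) ?_ ?_
    · rintro X n hX hn Y (rfl | rfl)
      · rw [g_nil]
        exact_mod_cast (bulbSocketsShift_ne_zero _ _).symm
      · rw [ih X hX, hn, mapFinite_coe, ne_eq, Nat.cast_inj]
        simp only [bulbSocketsShift]
        split_ifs <;> omega
    · intro X n hX hn j hj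
      by_cases hj0 : j = 0
      · exact Or.inl ⟨[], Or.inl rfl, by rw [g_nil, hj0]; rfl⟩
      refine (exists_bulbSocketsShift_eq hj0 hj).imp_left fun ⟨h, _⟩ => ⟨_, Or.inr rfl, ?_⟩
      have hmod : (m + 1 + 2 + 1) % 2 = (m + 2) % 2 := by omega
      rw [ih X hX, hn, mapFinite_coe, ← h]
      simp only [bulbSocketsShift, hmod]

theorem g_bulb_sockets_append_congr (m : ℕ) {X X' : Component} (hX : BulbHeaded X)
    (hX' : BulbHeaded X') (h : g X = g X') :
    g (Piece.bulb :: (sockets m ++ X)) = g (Piece.bulb :: (sockets m ++ X')) := by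
  match m with
  | 0 => exact (g_bulb_cons X hX).trans (h ▸ (g_bulb_cons X' hX').symm)
  | 1 => exact (g_bulb_socket_append X hX).trans (h ▸ (g_bulb_socket_append X' hX').symm)
  | m + 2 =>
    exact (g_bulb_sockets_append m X hX).trans (h ▸ (g_bulb_sockets_append m X' hX').symm)

/-- Colon Principle: If `X` and `X'` are bulb-headed components
with `g X = g X'` (as elements of `ℕ ∪ {∞}`), then
`g (bulb^k ++ socket^m ++ X) = g (bulb^k ++ socket^m ++ X')`. -/
theorem stmt9 (k m : ℕ) (X X' : Component)
    (hX : BulbHeaded X) (hX' : BulbHeaded X') (hgg : g X = g X') :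
    g (bulbs k ++ sockets m ++ X) = g (bulbs k ++ sockets m ++ X') := by
  cases k with
  | zero => exact (g_sockets_append m X hX).trans (hgg ▸ (g_sockets_append m X' hX').symm)
  | succ k =>
    have key : ∀ Y : Component, bulbs (k + 1) ++ sockets m ++ Y =
        bulbs k ++ Piece.bulb :: (sockets m ++ Y) := by
      intro Y
      simp [bulbs, List.replicate_succ']
    rw [key, key, (g_bulbs_append k (bulbHeaded_cons _)).2,
      (g_bulbs_append k (bulbHeaded_cons _)).2, g_bulb_sockets_append_congr m hX hX' hgg]
end

section
/- Every component of the form socket^m ++ bulb^n or of the form bulb^n ++ socket^m (m, n ≥ 0) has no carry-on options, and every option (component obtained by a single move) of such a component is again of one of these two forms. Consequently no carry-on move ever arises while playing such a component. -/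
theorem getElem?_sockets_append_bulbs (m n i : ℕ) :
    (sockets m ++ bulbs n)[i]? =
      if i < m then some Piece.socket else if i < m + n then some Piece.bulb else none := by
  simp only [sockets, bulbs, List.getElem?_append, List.getElem?_replicate, List.length_replicate]
  grind

theorem getElem?_bulbs_append_sockets (m n i : ℕ) :
    (bulbs n ++ sockets m)[i]? =
      if i < n then some Piece.bulb else if i < n + m then some Piece.socket else none := by
  simp only [sockets, bulbs, List.getElem?_append, List.getElem?_replicate, List.length_replicate]
  grind

theorem not_carryOption_sockets_append_bulbs (m n : ℕ) (L' : Component) :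
    ¬ CarryOption (sockets m ++ bulbs n) L' := by
  rintro ⟨i, hi, ⟨-, hl, -⟩, -⟩
  rw [getElem?_sockets_append_bulbs] at hi hl
  grind

theorem not_carryOption_bulbs_append_sockets (m n : ℕ) (L' : Component) :
    ¬ CarryOption (bulbs n ++ sockets m) L' := by
  rintro ⟨i, hi, ⟨-, -, hr⟩, -⟩
  rw [getElem?_bulbs_append_sockets] at hi hr
  grind

theorem QuietOption.of_sockets_append_bulbs {m n : ℕ} {L' : Component}
    (h : QuietOption (sockets m ++ bulbs n) L') :
    ∃ m' n', L' = sockets m' ++ bulbs n' := by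
  rcases h with ⟨i, -, rfl⟩ | ⟨i, hi, -, rfl⟩
  · exact ⟨min i m, min (i - m) n, by simp [sockets, bulbs, List.take_append]⟩
  · have him : i < m := by
      rw [getElem?_sockets_append_bulbs] at hi
      grind
    exact ⟨m - 1, n, by
      rw [List.eraseIdx_append_of_lt_length (by simpa [sockets] using him)]
      simp [sockets, List.eraseIdx_replicate, him]⟩

theorem QuietOption.of_bulbs_append_sockets {m n : ℕ} {L' : Component}
    (h : QuietOption (bulbs n ++ sockets m) L') :
    ∃ m' n', L' = bulbs n' ++ sockets m' := by
  rcases h with ⟨i, -, rfl⟩ | ⟨i, hi, -, rfl⟩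
  · exact ⟨min (i - n) m, min i n, by simp [sockets, bulbs, List.take_append]⟩
  · have hni : n ≤ i ∧ i - n < m := by
      rw [getElem?_bulbs_append_sockets] at hi
      grind
    exact ⟨m - 1, n, by
      rw [List.eraseIdx_append_of_length_le (by simpa [bulbs] using hni.1)]
      simp [sockets, bulbs, List.eraseIdx_replicate, hni.2]⟩

/-- Components of the form `socket^m ++ bulb^n` or
`bulb^n ++ socket^m` have no carry-on options, and every option of such a
component is again of one of these two forms. -/
theorem stmt10 (m n : ℕ) :
    (∀ L', ¬ CarryOption (sockets m ++ bulbs n) L') ∧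
    (∀ L', ¬ CarryOption (bulbs n ++ sockets m) L') ∧
    (∀ L', QuietOption (sockets m ++ bulbs n) L' ∨
        CarryOption (sockets m ++ bulbs n) L' →
      ∃ m' n', L' = sockets m' ++ bulbs n' ∨ L' = bulbs n' ++ sockets m') ∧
    (∀ L', QuietOption (bulbs n ++ sockets m) L' ∨
        CarryOption (bulbs n ++ sockets m) L' →
      ∃ m' n', L' = sockets m' ++ bulbs n' ∨ L' = bulbs n' ++ sockets m') := by
  refine ⟨not_carryOption_sockets_append_bulbs m n, not_carryOption_bulbs_append_sockets m n,
    fun L' h => ?_, fun L' h => ?_⟩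
  · obtain ⟨m', n', h'⟩ :=
      (h.resolve_right (not_carryOption_sockets_append_bulbs m n L')).of_sockets_append_bulbs
    exact ⟨m', n', .inl h'⟩
  · obtain ⟨m', n', h'⟩ :=
      (h.resolve_right (not_carryOption_bulbs_append_sockets m n L')).of_bulbs_append_sockets
    exact ⟨m', n', .inr h'⟩
end

section
/- The component [bulb, socket, bulb] has extended Grundy value ∞, and it is the unique component with at most 3 pieces whose extended Grundy value is ∞: every component of length at most 3 other than [bulb, socket, bulb] has finite extended Grundy value. In other words, [bulb, socket, bulb] is the simplest component whose value equals the moon. -/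
theorem gN_succ_of_no_carryOption {L : Component} (hC : ∀ L', ¬ CarryOption L L') (n : ℕ) :
    gN (n + 1) L =
      ((sInf {k : ℕ | ¬ ∃ L', QuietOption L L' ∧ gN n L' = (k : ℕ∞)} : ℕ) : ℕ∞) := by
  have hempty : ∀ k : ℕ, {v : ℕ∞ | ∃ L', CarryOption L L' ∧ gN n L' = v} ≠ {(k : ℕ∞)} := by
    intro k hk
    obtain ⟨L', hL', -⟩ := hk.symm.subset (Set.mem_singleton _)
    exact hC L' hL'
  rw [gN]
  simp only [hempty, false_and, exists_false, or_false, dite_false]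
  simp [hC]

/-- If the quiet options have exactly the values below `m`, then the value is `m`. -/
theorem gN_succ_eq_of_quietOption {L : Component} (hC : ∀ L', ¬ CarryOption L L') {n m : ℕ}
    (hS : ∀ k : ℕ, (∃ L', QuietOption L L' ∧ gN n L' = (k : ℕ∞)) ↔ k < m) :
    gN (n + 1) L = m := by
  rw [gN_succ_of_no_carryOption hC]
  simp only [hS, not_lt]
  congr 1
  exact csInf_Ici

theorem not_carryOption_of_length_le_three {L : Component} (hL : L.length ≤ 3)
    (hne : L ≠ [Piece.bulb, Piece.socket, Piece.bulb]) (L' : Component) :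
    ¬ CarryOption L L' := by
  rintro ⟨i, hi, ⟨hpos, hprev, hnext⟩, -⟩
  obtain ⟨hlt, -⟩ := List.getElem?_eq_some_iff.1 hnext
  obtain rfl : i = 1 := by omega
  match L, hL with
  | [], _ => simp at hlt
  | [_], _ => simp at hlt
  | [_, _], _ => simp at hlt
  | [a, b, c], _ => simp_all

theorem quietOption_bulb_iff {L' : Component} : QuietOption [Piece.bulb] L' ↔ L' = [] := by
  constructor
  · rintro (⟨i, hi, rfl⟩ | ⟨i, hi, -, rfl⟩) <;> rcases i with _ | i <;> simp_all
  · rintro rfl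
    exact Or.inl ⟨0, rfl, rfl⟩

theorem quietOption_bulb_bulb_iff {L' : Component} :
    QuietOption [Piece.bulb, Piece.bulb] L' ↔ L' = [] ∨ L' = [Piece.bulb] := by
  constructor
  · rintro (⟨i, hi, rfl⟩ | ⟨i, hi, -, rfl⟩) <;> rcases i with _ | _ | i <;> simp_all
  · rintro (rfl | rfl)
    · exact Or.inl ⟨0, rfl, rfl⟩
    · exact Or.inl ⟨1, rfl, rfl⟩

theorem quietOption_bulb_socket_iff {L' : Component} :
    QuietOption [Piece.bulb, Piece.socket] L' ↔ L' = [] ∨ L' = [Piece.bulb] := by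
  constructor
  · rintro (⟨i, hi, rfl⟩ | ⟨i, hi, -, rfl⟩) <;> rcases i with _ | _ | i <;> simp_all
  · rintro (rfl | rfl)
    · exact Or.inl ⟨0, rfl, rfl⟩
    · exact Or.inr ⟨1, rfl, by simp [Sandwiched], rfl⟩

theorem carryOption_bulb_socket_bulb_iff {L' : Component} :
    CarryOption [Piece.bulb, Piece.socket, Piece.bulb] L' ↔ L' = [Piece.bulb, Piece.bulb] := by
  constructor
  · rintro ⟨i, hi, -, rfl⟩
    rcases i with _ | _ | _ | i <;> simp_all
  · rintro rfl
    exact ⟨1, rfl, ⟨one_pos, rfl, rfl⟩, rfl⟩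

theorem gN_one_bulb : gN 1 [Piece.bulb] = 1 := by
  refine gN_succ_eq_of_quietOption (m := 1)
    (not_carryOption_of_length_le_three (by simp) (by simp)) fun k => ?_
  simp only [quietOption_bulb_iff, exists_eq_left, gN_nil]
  norm_cast
  omega

theorem gN_two_eq_two {L : Component} (hlen : L.length = 2)
    (hL : ∀ L', QuietOption L L' ↔ L' = [] ∨ L' = [Piece.bulb]) : gN 2 L = 2 := by
  refine gN_succ_eq_of_quietOption (m := 2)
    (not_carryOption_of_length_le_three (by omega) (by rintro rfl; simp at hlen)) fun k => ?_
  simp only [hL, or_and_right, exists_or, exists_eq_left, gN_nil, gN_one_bulb]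
  norm_cast
  omega

theorem g_bulb_socket_bulb : g [Piece.bulb, Piece.socket, Piece.bulb] = (⊤ : ℕ∞) := by
  have hBB : gN 2 [Piece.bulb, Piece.bulb] = 2 :=
    gN_two_eq_two rfl fun _ => quietOption_bulb_bulb_iff
  have hBS : gN 2 [Piece.bulb, Piece.socket] = 2 :=
    gN_two_eq_two rfl fun _ => quietOption_bulb_socket_iff
  change gN (2 + 1) _ = _
  rw [gN]
  refine if_pos (Or.inr (Or.inr ⟨2, ?_, [Piece.bulb, Piece.socket], ?_, hBS⟩))
  · ext v
    simp only [carryOption_bulb_socket_bulb_iff, exists_eq_left, hBB, Set.mem_ofPred_eq,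
      Set.mem_singleton_iff]
    exact eq_comm
  · exact Or.inl ⟨2, rfl, rfl⟩

theorem g_ne_top_of_no_carryOption {L : Component} (hC : ∀ L', ¬ CarryOption L L') :
    g L ≠ (⊤ : ℕ∞) := by
  rw [g]
  cases L.length with
  | zero => exact ENat.zero_ne_top
  | succ n =>
    rw [gN_succ_of_no_carryOption hC]
    exact ENat.natCast_ne_top _

/-- `[bulb, socket, bulb]` has extended Grundy value `∞`, and it
is the unique component with at most 3 pieces whose extended Grundy value is
`∞`. -/
theorem stmt11 :
    g [Piece.bulb, Piece.socket, Piece.bulb] = (⊤ : ℕ∞) ∧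
    ∀ L : Component, L.length ≤ 3 →
      L ≠ [Piece.bulb, Piece.socket, Piece.bulb] → g L ≠ (⊤ : ℕ∞) :=
  ⟨g_bulb_socket_bulb, fun _ hL hne =>
    g_ne_top_of_no_carryOption (not_carryOption_of_length_le_three hL hne)⟩
end
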